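/- arXiv:2408.17074 — 9 statements merged into one kernel-verified Lean document; each statement's English description precedes it below -/
import Mathlib

section
/- Fix an index j, a regularization parameter α > 0 and a scalar γ > 0. If the element x = γφ_j minimizes the functional J(x) = (1/2)‖Kx − Kφ_j‖² + α∑_i |⟨x,φ_i⟩| among all x ∈ X for which the series ∑_i |⟨x,φ_i⟩| converges, then |⟨Kφ_j, Kφ_l⟩| ≤ ⟨Kφ_j, Kφ_j⟩ for every index l. -/
open scoped RealInnerProductSpace

theorem neg_le_of_forall_nonneg_quadratic {A B C δ : ℝ} (hδ : 0 < δ)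
    (h : ∀ t, 0 < t → t ≤ δ → 0 ≤ A * t + B * t ^ 2 + C * t) : -A ≤ C := by
  by_contra! hlt
  set D := -A - C with hD
  have hDpos : 0 < D := by linarith
  have hB : 0 < |B| + 1 := by positivity
  set t := min δ (D / (|B| + 1)) with ht
  have htpos : 0 < t := lt_min hδ (by positivity)
  have htD : t * (|B| + 1) ≤ D := (le_div_iff₀ hB).1 (min_le_right _ _)
  have hlt' : B * t < D := by nlinarith [le_abs_self B]
  have hnn := h t htpos (min_le_left _ _)
  nlinarith [mul_pos htpos (sub_pos.2 hlt')]

/-- First-order optimality at `0` for a quadratic plus a multiple of the absolute value. -/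
theorem abs_le_of_forall_nonneg_quadratic_add_abs {A B C δ : ℝ} (hδ : 0 < δ)
    (h : ∀ t, |t| ≤ δ → 0 ≤ A * t + B * t ^ 2 + C * |t|) : |A| ≤ C := by
  refine abs_le'.2 ⟨?_, ?_⟩
  · have := neg_le_of_forall_nonneg_quadratic (A := -A) (B := B) (C := C) hδ fun t ht htδ => by
      have := h (-t) (by rwa [abs_neg, abs_of_pos ht])
      rw [abs_neg, abs_of_pos ht] at this
      linarith
    linarith
  · refine neg_le_of_forall_nonneg_quadratic (B := B) hδ fun t ht htδ => ?_
    have := h t (by rwa [abs_of_pos ht])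
    rwa [abs_of_pos ht] at this

theorem HilbertBasis.hasSum_abs_inner_smul {X : Type*} [NormedAddCommGroup X]
    [InnerProductSpace ℝ X] {ι : Type*} (φ : HilbertBasis ι ℝ X) (j : ι) (c : ℝ) :
    HasSum (fun i => |⟪c • φ j, φ i⟫|) |c| := by
  classical
  have horth := orthonormal_iff_ite.1 φ.orthonormal
  convert hasSum_ite_eq j |c| using 2 with i
  rw [real_inner_smul_left, horth]
  by_cases hij : i = j
  · simp [hij]
  · simp [hij, Ne.symm hij]

theorem norm_smul_add_smul_sq {Y : Type*} [NormedAddCommGroup Y] [InnerProductSpace ℝ Y]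
    (a b : Y) (r t : ℝ) :
    ‖r • a + t • b‖ ^ 2 = r ^ 2 * ⟪a, a⟫ + 2 * (r * t * ⟪a, b⟫) + t ^ 2 * ⟪b, b⟫ := by
  rw [← real_inner_self_eq_norm_sq]
  simp only [inner_add_left, inner_add_right, real_inner_smul_left, real_inner_smul_right,
    real_inner_comm a b]
  ring

/-- If `x = γ • φ j` minimizes
`J(x) = (1/2)‖Kx − Kφ_j‖² + α ∑_i |⟨x,φ_i⟩|` among all `x` whose series converges,
then `|⟨Kφ_j, Kφ_l⟩| ≤ ⟨Kφ_j, Kφ_j⟩` for every `l`. -/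
theorem stmt_0
    {X Y : Type*} [NormedAddCommGroup X] [InnerProductSpace ℝ X]
    [NormedAddCommGroup Y] [InnerProductSpace ℝ Y]
    (φ : HilbertBasis ℕ ℝ X) (K : X →L[ℝ] Y)
    (j : ℕ) (α γ : ℝ) (hα : 0 < α) (hγ : 0 < γ)
    (J : X → ℝ)
    (hJ : ∀ x : X,
      J x = (1 / 2) * ‖K x - K (φ j)‖ ^ 2 + α * ∑' i : ℕ, |⟪x, φ i⟫|)
    (hmin : ∀ x : X, Summable (fun i : ℕ => |⟪x, φ i⟫|) →
      J (γ • φ j) ≤ J x) :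
    ∀ l : ℕ, |⟪K (φ j), K (φ l)⟫| ≤ ⟪K (φ j), K (φ j)⟫ := by
  have hJγ : J (γ • φ j) = (1 / 2) * ((γ - 1) ^ 2 * ⟪K (φ j), K (φ j)⟫) + α * γ := by
    rw [hJ, (φ.hasSum_abs_inner_smul j γ).tsum_eq, abs_of_pos hγ, map_smul,
      show γ • K (φ j) - K (φ j) = (γ - 1) • K (φ j) + (0 : ℝ) • K (φ j) by module,
      norm_smul_add_smul_sq]
    ring
  have hstat : (γ - 1) * ⟪K (φ j), K (φ j)⟫ + α = 0 := by
    refine abs_nonpos_iff.1 (abs_le_of_forall_nonneg_quadratic_add_abs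
      (B := (1 / 2) * ⟪K (φ j), K (φ j)⟫) hγ fun t ht => ?_)
    have hsum := φ.hasSum_abs_inner_smul j (γ + t)
    have hle := hmin _ hsum.summable
    rw [hJγ, hJ, hsum.tsum_eq, abs_of_nonneg (by linarith [(abs_le.1 ht).1]), map_smul,
      show (γ + t) • K (φ j) - K (φ j) = (γ - 1) • K (φ j) + t • K (φ j) by module,
      norm_smul_add_smul_sq] at hle
    linarith
  intro l
  have hbound : |(γ - 1) * ⟪K (φ j), K (φ l)⟫| ≤ α := by
    refine abs_le_of_forall_nonneg_quadratic_add_abs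
      (B := (1 / 2) * ⟪K (φ l), K (φ l)⟫) one_pos fun t _ => ?_
    have hsum := (φ.hasSum_abs_inner_smul j γ).add (φ.hasSum_abs_inner_smul l t)
    have hterm (i : ℕ) :
        |⟪γ • φ j + t • φ l, φ i⟫| ≤ |⟪γ • φ j, φ i⟫| + |⟪t • φ l, φ i⟫| := by
      rw [inner_add_left]
      exact abs_add_le _ _
    have hsummable : Summable fun i => |⟪γ • φ j + t • φ l, φ i⟫| :=
      hsum.summable.of_nonneg_of_le (fun _ => abs_nonneg _) hterm
    have htsum := hasSum_le hterm hsummable.hasSum hsum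
    rw [abs_of_pos hγ] at htsum
    have hle := hmin _ hsummable
    rw [hJγ, hJ, map_add, map_smul, map_smul,
      show γ • K (φ j) + t • K (φ l) - K (φ j) = (γ - 1) • K (φ j) + t • K (φ l) by module,
      norm_smul_add_smul_sq] at hle
    linarith [mul_le_mul_of_nonneg_left htsum hα.le]
  have hnonneg : 0 ≤ ⟪K (φ j), K (φ j)⟫ := real_inner_self_nonneg
  have hγ1 : 0 < 1 - γ := by
    by_contra! h
    nlinarith [mul_nonneg (by linarith : 0 ≤ γ - 1) hnonneg]
  rw [abs_mul, abs_sub_comm, abs_of_pos hγ1] at hbound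
  refine le_of_mul_le_mul_left ?_ hγ1
  linarith
end

section
/- Fix an index j with ‖Pφ_j‖ ≥ τ and let 0 < α < ‖Pφ_j‖. Then x* = (1 − α/‖Pφ_j‖)φ_j minimizes the weighted sparsity functional J(x) = (1/2)‖Px − Pφ_j‖² + α∑_i w_i|⟨x,φ_i⟩| among all x ∈ X for which the series ∑_i w_i|⟨x,φ_i⟩| converges. -/
open scoped RealInnerProductSpace

/-- Fenchel–Young inequality for the square norm, tested against `a` rescaled to norm `α`. -/
lemma half_sq_norm_sub_ge {X : Type*} [NormedAddCommGroup X] [InnerProductSpace ℝ X]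
    (y a : X) (α : ℝ) (ha : ‖a‖ ≠ 0) :
    α * ‖a‖ - α / ‖a‖ * ⟪y, a⟫ - α ^ 2 / 2 ≤ (1 / 2) * ‖y - a‖ ^ 2 := by
  have h := sq_nonneg ‖(y - a) + (α / ‖a‖) • a‖
  rw [norm_add_sq_real, inner_smul_right, inner_sub_left, real_inner_self_eq_norm_sq,
    norm_smul, mul_pow, Real.norm_eq_abs, sq_abs] at h
  have h₁ : (α / ‖a‖) ^ 2 * ‖a‖ ^ 2 = α ^ 2 := by field_simp
  have h₂ : α / ‖a‖ * ‖a‖ ^ 2 = α * ‖a‖ := by field_simp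
  linarith

/-- A symmetric map `P` is controlled by the norms of its values on a Hilbert basis. -/
lemma inner_map_le_norm_mul_tsum {ι X : Type*} [NormedAddCommGroup X] [InnerProductSpace ℝ X]
    (φ : HilbertBasis ι ℝ X) (P : X → X) (hP : ∀ x y : X, ⟪P x, y⟫ = ⟪x, P y⟫)
    (w : ι → ℝ) (hw : ∀ i, ‖P (φ i)‖ ≤ w i) (x y : X)
    (hx : Summable fun i => w i * |⟪x, φ i⟫|) :
    ⟪P x, y⟫ ≤ ‖y‖ * ∑' i, w i * |⟪x, φ i⟫| := by
  rw [hP]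
  refine hasSum_le (fun i => ?_) (φ.hasSum_inner_mul_inner x (P y)) (hx.hasSum.mul_left ‖y‖)
  rw [← hP]
  calc ⟪x, φ i⟫ * ⟪P (φ i), y⟫ ≤ |⟪x, φ i⟫| * |⟪P (φ i), y⟫| := by
        rw [← abs_mul]; exact le_abs_self _
    _ ≤ |⟪x, φ i⟫| * (w i * ‖y‖) := by
        gcongr
        exact (abs_real_inner_le_norm _ _).trans (by gcongr; exact hw i)
    _ = ‖y‖ * (w i * |⟪x, φ i⟫|) := by ring

/-- With weights `w i = max(‖Pφ_i‖, τ)`, if `‖Pφ_j‖ ≥ τ` and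
`0 < α < ‖Pφ_j‖`, then `x* = (1 − α/‖Pφ_j‖) • φ_j` minimizes
`J(x) = (1/2)‖Px − Pφ_j‖² + α ∑_i w_i |⟨x,φ_i⟩|` among all `x` whose series converges. -/
theorem stmt_2
    {X : Type*} [NormedAddCommGroup X] [InnerProductSpace ℝ X]
    (φ : HilbertBasis ℕ ℝ X) {k : ℕ} (v : Fin k → X) (hv : Orthonormal ℝ v)
    (P : X → X) (hP : ∀ x : X, P x = ∑ i : Fin k, ⟪x, v i⟫ • v i)
    (τ : ℝ) (hτ : 0 < τ)
    (w : ℕ → ℝ) (hw : ∀ i : ℕ, w i = max ‖P (φ i)‖ τ)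
    (j : ℕ) (hj : τ ≤ ‖P (φ j)‖)
    (α : ℝ) (hα0 : 0 < α) (hα1 : α < ‖P (φ j)‖)
    (J : X → ℝ)
    (hJ : ∀ x : X,
      J x = (1 / 2) * ‖P x - P (φ j)‖ ^ 2 + α * ∑' i : ℕ, w i * |⟪x, φ i⟫|) :
    ∀ x : X, Summable (fun i : ℕ => w i * |⟪x, φ i⟫|) →
      J ((1 - α / ‖P (φ j)‖) • φ j) ≤ J x := by
  intro x hx
  have hN : 0 < ‖P (φ j)‖ := hα0.trans hα1
  have hsymm : ∀ x y : X, ⟪P x, y⟫ = ⟪x, P y⟫ := by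
    intro x y
    simp only [hP, sum_inner, inner_sum, inner_smul_left, inner_smul_right]
    refine Finset.sum_congr rfl fun i _ => ?_
    rw [real_inner_comm y (v i)]
    simp [mul_comm]
  have hsmul : ∀ (c : ℝ) (x : X), P (c • x) = c • P x := by
    intro c x
    simp [hP, inner_smul_left, Finset.smul_sum, mul_smul]
  have hc : 0 ≤ 1 - α / ‖P (φ j)‖ := by
    rw [sub_nonneg, div_le_one hN]
    exact hα1.le
  have htsum : ∑' i : ℕ, w i * |⟪(1 - α / ‖P (φ j)‖) • φ j, φ i⟫| = ‖P (φ j)‖ - α := by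
    rw [tsum_eq_single j]
    · rw [hw, max_eq_left hj, inner_smul_left, real_inner_self_eq_norm_sq, φ.orthonormal.1 j]
      simp only [conj_trivial, one_pow, mul_one]
      rw [abs_of_nonneg hc]
      field_simp
    · intro i hi
      simp [inner_smul_left, φ.orthonormal.2 hi.symm]
  have hres : ‖P ((1 - α / ‖P (φ j)‖) • φ j) - P (φ j)‖ = α := by
    rw [hsmul, sub_smul, one_smul, sub_sub_cancel_left, norm_neg, norm_smul, Real.norm_eq_abs,
      abs_of_nonneg (by positivity)]
    field_simp
  rw [hJ, hJ, htsum, hres]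
  have h₁ := half_sq_norm_sub_ge (P x) (P (φ j)) α hN.ne'
  have h₂ : α / ‖P (φ j)‖ * ⟪P x, P (φ j)⟫ ≤ α * ∑' i : ℕ, w i * |⟪x, φ i⟫| := by
    rw [div_mul_eq_mul_div, mul_div_assoc]
    gcongr
    rw [div_le_iff₀' hN]
    exact inner_map_le_norm_mul_tsum φ P hsymm w
      (fun i => (le_max_left _ _).trans_eq (hw i).symm) x _ hx
  linarith
end

section
/- Fix an index j with ‖Pφ_j‖ ≥ τ, let 0 < α < ‖Pφ_j‖, and assume in addition that Pφ_l ≠ c·Pφ_q for all indices l ≠ q and all real scalars c. Then x* = (1 − α/‖Pφ_j‖)φ_j is the unique minimizer of J(x) = (1/2)‖Px − Pφ_j‖² + α∑_i w_i|⟨x,φ_i⟩|: every x ∈ X with x ≠ x* for which the series ∑_i w_i|⟨x,φ_i⟩| converges satisfies J(x) > J(x*). -/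
open scoped RealInnerProductSpace

/-- Parseval's expansion of `⟪x, P y⟫` for a symmetric operator `P`. -/
lemma HilbertBasis.hasSum_inner_mul_inner_of_symmetric
    {ι X : Type*} [NormedAddCommGroup X] [InnerProductSpace ℝ X] (φ : HilbertBasis ι ℝ X)
    {P : X → X} (hP : ∀ x y : X, ⟪P x, y⟫ = ⟪x, P y⟫) (x y : X) :
    HasSum (fun i => ⟪x, φ i⟫ * ⟪P (φ i), y⟫) ⟪P x, y⟫ := by
  simpa only [hP] using φ.hasSum_inner_mul_inner x (P y)

/-- Strict Cauchy–Schwarz inequality for a vector that is not a multiple of another one. -/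
lemma abs_real_inner_lt_norm_mul_norm {X : Type*} [NormedAddCommGroup X] [InnerProductSpace ℝ X]
    {x y : X} (hy : y ≠ 0) (h : ∀ c : ℝ, x ≠ c • y) : |⟪x, y⟫| < ‖x‖ * ‖y‖ := by
  refine lt_of_le_of_ne (abs_real_inner_le_norm x y) fun heq => ?_
  have heq' : ‖⟪y, x⟫‖ = ‖y‖ * ‖x‖ := by
    rw [real_inner_comm, Real.norm_eq_abs, heq, mul_comm]
  have hx : x ≠ 0 := by simpa using h 0
  obtain ⟨c, -, hc⟩ := (norm_inner_eq_norm_iff (𝕜 := ℝ) hy hx).1 heq'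
  exact h c hc

/-- A vector whose coefficients vanish off `j` is a multiple of the `j`-th basis vector. -/
lemma HilbertBasis.eq_inner_smul_of_forall_ne {ι X : Type*} [NormedAddCommGroup X]
    [InnerProductSpace ℝ X] (φ : HilbertBasis ι ℝ X) {x : X} {j : ι}
    (h : ∀ i, i ≠ j → ⟪x, φ i⟫ = 0) : x = ⟪x, φ j⟫ • φ j := by
  have hs := φ.hasSum_repr x
  simp only [φ.repr_apply_apply, real_inner_comm] at hs
  refine hs.unique (hasSum_single j fun i hi => ?_)
  rw [h i hi, zero_smul]

/-- Completing the square in the quadratic part of the functional. -/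
lemma half_norm_sub_sq_eq {X : Type*} [NormedAddCommGroup X] [InnerProductSpace ℝ X]
    (y p : X) (t : ℝ) :
    1 / 2 * ‖y - p‖ ^ 2 = 1 / 2 * ‖y - (1 - t) • p‖ ^ 2 - t * ⟪y, p⟫
      + (t - t ^ 2 / 2) * ‖p‖ ^ 2 := by
  rw [norm_sub_sq_real, norm_sub_sq_real, inner_smul_right, norm_smul, mul_pow,
    Real.norm_eq_abs, sq_abs]
  ring

/-- Under the additional non-parallelism assumption
`Pφ_l ≠ c • Pφ_q` for `l ≠ q`, the element `x* = (1 − α/‖Pφ_j‖) • φ_j` is the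
unique minimizer of `J`: every admissible `x ≠ x*` satisfies `J(x) > J(x*)`. -/
theorem stmt_3
    {X : Type*} [NormedAddCommGroup X] [InnerProductSpace ℝ X]
    (φ : HilbertBasis ℕ ℝ X) {k : ℕ} (v : Fin k → X) (hv : Orthonormal ℝ v)
    (P : X → X) (hP : ∀ x : X, P x = ∑ i : Fin k, ⟪x, v i⟫ • v i)
    (τ : ℝ) (hτ : 0 < τ)
    (w : ℕ → ℝ) (hw : ∀ i : ℕ, w i = max ‖P (φ i)‖ τ)
    (j : ℕ) (hj : τ ≤ ‖P (φ j)‖)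
    (α : ℝ) (hα0 : 0 < α) (hα1 : α < ‖P (φ j)‖)
    (hpar : ∀ l q : ℕ, l ≠ q → ∀ c : ℝ, P (φ l) ≠ c • P (φ q))
    (J : X → ℝ)
    (hJ : ∀ x : X,
      J x = (1 / 2) * ‖P x - P (φ j)‖ ^ 2 + α * ∑' i : ℕ, w i * |⟪x, φ i⟫|) :
    ∀ x : X, x ≠ (1 - α / ‖P (φ j)‖) • φ j →
      Summable (fun i : ℕ => w i * |⟪x, φ i⟫|) →
      J ((1 - α / ‖P (φ j)‖) • φ j) < J x := by
  intro x hx hS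
  have hsymm : ∀ x y : X, ⟪P x, y⟫ = ⟪x, P y⟫ := fun x y => by
    simp only [hP, sum_inner, inner_sum, real_inner_smul_left, real_inner_smul_right]
    exact Finset.sum_congr rfl fun i _ => by rw [real_inner_comm y (v i)]; ring
  have hsmul : ∀ (c : ℝ) (x : X), P (c • x) = c • P x := fun c x => by
    simp only [hP, real_inner_smul_left, mul_smul, Finset.smul_sum]
  set p := P (φ j) with hp
  have hn : 0 < ‖p‖ := hτ.trans_le hj
  set t := α / ‖p‖ with ht
  have hα : α = t * ‖p‖ := by rw [ht, div_mul_cancel₀ _ hn.ne']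
  have ht0 : 0 < t := div_pos hα0 hn
  have ht1 : t < 1 := (div_lt_one hn).2 hα1
  have hT := φ.hasSum_inner_mul_inner_of_symmetric hsymm x p
  have hS' := hS.hasSum.mul_right ‖p‖
  have hle : ∀ i, ⟪x, φ i⟫ * ⟪P (φ i), p⟫ ≤ w i * |⟪x, φ i⟫| * ‖p‖ := fun i => calc
    ⟪x, φ i⟫ * ⟪P (φ i), p⟫ ≤ |⟪x, φ i⟫| * |⟪P (φ i), p⟫| := by
      rw [← abs_mul]; exact le_abs_self _
    _ ≤ |⟪x, φ i⟫| * (w i * ‖p‖) := by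
      gcongr
      refine (abs_real_inner_le_norm _ _).trans ?_
      gcongr
      rw [hw]; exact le_max_left _ _
    _ = w i * |⟪x, φ i⟫| * ‖p‖ := by ring
  have hTS := hasSum_le hle hT hS'
  have hJstar : J ((1 - t) • φ j) = (t - t ^ 2 / 2) * ‖p‖ ^ 2 := by
    have hsum : ∑' i, w i * |⟪(1 - t) • φ j, φ i⟫| = ‖p‖ * (1 - t) := by
      rw [tsum_eq_single j]
      · rw [hw, ← hp, max_eq_left hj, real_inner_smul_left, real_inner_self_eq_norm_sq,
          φ.orthonormal.1 j, one_pow, mul_one, abs_of_pos (sub_pos.2 ht1)]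
      · intro i hi
        rw [real_inner_smul_left, φ.orthonormal.2 hi.symm, mul_zero, abs_zero, mul_zero]
    rw [hJ, hsum, half_norm_sub_sq_eq _ p t, hsmul, ← hp, sub_self, norm_zero,
      real_inner_smul_left, real_inner_self_eq_norm_sq, hα]
    ring
  rw [hJstar, hJ, half_norm_sub_sq_eq _ p t, hα]
  by_cases hcoef : ∀ i, i ≠ j → ⟪x, φ i⟫ = 0
  · have hxj := φ.eq_inner_smul_of_forall_ne hcoef
    have hd : P x - (1 - t) • p ≠ 0 := by
      rw [hxj, hsmul, ← hp, ← sub_smul]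
      refine smul_ne_zero (sub_ne_zero.2 fun h => hx ?_) (norm_pos_iff.1 hn)
      rw [hxj, h]
    have hd2 : 0 < ‖P x - (1 - t) • p‖ ^ 2 := by positivity
    nlinarith [mul_le_mul_of_nonneg_left hTS ht0.le]
  · push Not at hcoef
    obtain ⟨i, hij, hi⟩ := hcoef
    have hlt : ⟪x, φ i⟫ * ⟪P (φ i), p⟫ < w i * |⟪x, φ i⟫| * ‖p‖ := calc
      ⟪x, φ i⟫ * ⟪P (φ i), p⟫ ≤ |⟪x, φ i⟫| * |⟪P (φ i), p⟫| := by
        rw [← abs_mul]; exact le_abs_self _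
      _ < |⟪x, φ i⟫| * (‖P (φ i)‖ * ‖p‖) :=
        mul_lt_mul_of_pos_left
          (abs_real_inner_lt_norm_mul_norm (norm_pos_iff.1 hn) (hpar i j hij)) (abs_pos.2 hi)
      _ ≤ |⟪x, φ i⟫| * (w i * ‖p‖) := by
        gcongr
        rw [hw]; exact le_max_left _ _
      _ = w i * |⟪x, φ i⟫| * ‖p‖ := by ring
    have hTS' := hasSum_lt hle hlt hT hS'
    nlinarith [mul_lt_mul_of_pos_left hTS' ht0, sq_nonneg ‖P x - (1 - t) • p‖]
end

section
/- Fix an index j with ‖Pφ_j‖ ≥ τ, let 0 < α < ‖Pφ_j‖, set γ = 1 − α/‖Pφ_j‖, and let J(x) = (1/2)‖Px − Pφ_j‖² + α∑_i w_i|⟨x,φ_i⟩|. Then J(γφ_j) = α²/2 + αγw_j, and every z ∈ X for which ∑_i w_i|⟨z,φ_i⟩| converges satisfies J(z) ≥ α²/2 + αγw_j + (1/2)‖P(z − γφ_j)‖². -/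
open scoped RealInnerProductSpace

/-- The orthogonal projection onto the span of an orthonormal family satisfies
`⟪Px, Py⟫ = ⟪x, Py⟫`. -/
theorem Orthonormal.inner_sum_inner_smul_sum_inner_smul
    {X ι : Type*} [NormedAddCommGroup X] [InnerProductSpace ℝ X] [Fintype ι]
    {v : ι → X} (hv : Orthonormal ℝ v) (x y : X) :
    ⟪∑ i, ⟪x, v i⟫ • v i, ∑ i, ⟪y, v i⟫ • v i⟫ = ⟪x, ∑ i, ⟪y, v i⟫ • v i⟫ := by
  rw [hv.inner_sum, inner_sum]
  exact Finset.sum_congr rfl fun i _ => by simp [real_inner_smul_right, mul_comm]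

/-- If `w i` bounds `|⟪φ i, u⟫| / n`, then `n` times the weighted `ℓ¹` norm of the coefficients
of `z` bounds `⟪z, u⟫`. -/
theorem HilbertBasis.inner_le_mul_tsum_mul_abs_inner
    {X ι : Type*} [NormedAddCommGroup X] [InnerProductSpace ℝ X]
    (φ : HilbertBasis ι ℝ X) {w : ι → ℝ} {n : ℝ} {u z : X}
    (hu : ∀ i, |⟪φ i, u⟫| ≤ n * w i)
    (hz : Summable fun i => w i * |⟪z, φ i⟫|) :
    ⟪z, u⟫ ≤ n * ∑' i, w i * |⟪z, φ i⟫| := by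
  refine hasSum_le (fun i => ?_) (φ.hasSum_inner_mul_inner z u) (hz.hasSum.mul_left n)
  calc ⟪z, φ i⟫ * ⟪φ i, u⟫ ≤ |⟪z, φ i⟫| * |⟪φ i, u⟫| := by
        rw [← abs_mul]; exact le_abs_self _
    _ ≤ |⟪z, φ i⟫| * (n * w i) := by gcongr; exact hu i
    _ = n * (w i * |⟪z, φ i⟫|) := by ring

/-- With `γ = 1 − α/‖Pφ_j‖`, one has `J(γφ_j) = α²/2 + αγw_j`, and
every admissible `z` satisfies `J(z) ≥ α²/2 + αγw_j + (1/2)‖P(z − γφ_j)‖²`. -/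
theorem stmt_4
    {X : Type*} [NormedAddCommGroup X] [InnerProductSpace ℝ X]
    (φ : HilbertBasis ℕ ℝ X) {k : ℕ} (v : Fin k → X) (hv : Orthonormal ℝ v)
    (P : X → X) (hP : ∀ x : X, P x = ∑ i : Fin k, ⟪x, v i⟫ • v i)
    (τ : ℝ) (hτ : 0 < τ)
    (w : ℕ → ℝ) (hw : ∀ i : ℕ, w i = max ‖P (φ i)‖ τ)
    (j : ℕ) (hj : τ ≤ ‖P (φ j)‖)
    (α : ℝ) (hα0 : 0 < α) (hα1 : α < ‖P (φ j)‖)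
    (γ : ℝ) (hγ : γ = 1 - α / ‖P (φ j)‖)
    (J : X → ℝ)
    (hJ : ∀ x : X,
      J x = (1 / 2) * ‖P x - P (φ j)‖ ^ 2 + α * ∑' i : ℕ, w i * |⟪x, φ i⟫|) :
    J (γ • φ j) = α ^ 2 / 2 + α * γ * w j ∧
    ∀ z : X, Summable (fun i : ℕ => w i * |⟪z, φ i⟫|) →
      α ^ 2 / 2 + α * γ * w j + (1 / 2) * ‖P (z - γ • φ j)‖ ^ 2 ≤ J z := by
  have hP_inner : ∀ x y, ⟪P x, P y⟫ = ⟪x, P y⟫ := fun x y => by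
    rw [hP x, hP y]; exact hv.inner_sum_inner_smul_sum_inner_smul x y
  have hP_smul : ∀ (c : ℝ) x, P (c • x) = c • P x := fun c x => by
    simp only [hP, Finset.smul_sum, real_inner_smul_left, mul_smul]
  have hP_sub : ∀ x y, P (x - y) = P x - P y := fun x y => by
    simp only [hP, inner_sub_left, sub_smul, Finset.sum_sub_distrib]
  have hn : 0 < ‖P (φ j)‖ := hτ.trans_le hj
  have hwj : w j = ‖P (φ j)‖ := by rw [hw, max_eq_left hj]
  have hγn : γ * ‖P (φ j)‖ = ‖P (φ j)‖ - α := by rw [hγ]; field_simp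
  have hγ0 : 0 ≤ γ := by
    rw [hγ, sub_nonneg, div_le_one hn]; exact hα1.le
  constructor
  · have h_tsum : ∑' i, w i * |⟪γ • φ j, φ i⟫| = γ * w j := by
      rw [tsum_eq_single j]
      · simp [real_inner_smul_left, φ.orthonormal.1 j, abs_of_nonneg hγ0, mul_comm]
      · intro i hi
        simp [real_inner_smul_left, φ.orthonormal.2 hi.symm]
    have h_norm : ‖P (γ • φ j) - P (φ j)‖ ^ 2 = α ^ 2 := by
      rw [norm_sub_sq_real, hP_smul, norm_smul, real_inner_smul_left,
        real_inner_self_eq_norm_sq, Real.norm_of_nonneg hγ0]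
      linear_combination (γ * ‖P (φ j)‖ - ‖P (φ j)‖ - α) * hγn
    rw [hJ, h_tsum, h_norm]
    ring
  · intro z hz
    have h_inner : ⟪z, P (φ j)⟫ ≤ ‖P (φ j)‖ * ∑' i, w i * |⟪z, φ i⟫| := by
      refine φ.inner_le_mul_tsum_mul_abs_inner (fun i => ?_) hz
      rw [← hP_inner, hw, mul_comm]
      exact (abs_real_inner_le_norm _ _).trans (by gcongr; exact le_max_left _ _)
    have h_div : α / ‖P (φ j)‖ * ⟪z, P (φ j)⟫ ≤ α * ∑' i, w i * |⟪z, φ i⟫| := by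
      rw [div_mul_eq_mul_div, div_le_iff₀ hn]
      linear_combination α * h_inner
    have h_coeff : α / ‖P (φ j)‖ = 1 - γ := by rw [hγ]; ring
    rw [h_coeff] at h_div
    rw [hJ, hP_sub, hP_smul, norm_sub_sq_real, norm_sub_sq_real, real_inner_smul_right,
      norm_smul, Real.norm_of_nonneg hγ0, hP_inner, hwj, hγn]
    linear_combination h_div + α * hγn
end

section
/- Fix an index j with ‖Pφ_j‖ ≥ τ. If x ∈ X satisfies Px = Pφ_j and the series ∑_i w_i|⟨x,φ_i⟩| converges, then ∑_i w_i|⟨x,φ_i⟩| ≥ w_j, i.e. the weighted ℓ¹ value of x is at least the weighted ℓ¹ value of φ_j. -/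
open scoped RealInnerProductSpace

/-- If `‖Pφ_j‖ ≥ τ`, `Px = Pφ_j` and the weighted ℓ¹ series of `x`
converges, then `∑_i w_i|⟨x,φ_i⟩| ≥ w_j`. -/
theorem stmt_5
    {X : Type*} [NormedAddCommGroup X] [InnerProductSpace ℝ X]
    (φ : HilbertBasis ℕ ℝ X) {k : ℕ} (v : Fin k → X) (hv : Orthonormal ℝ v)
    (P : X → X) (hP : ∀ x : X, P x = ∑ i : Fin k, ⟪x, v i⟫ • v i)
    (τ : ℝ) (hτ : 0 < τ)
    (w : ℕ → ℝ) (hw : ∀ i : ℕ, w i = max ‖P (φ i)‖ τ)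
    (j : ℕ) (hj : τ ≤ ‖P (φ j)‖)
    (x : X) (hx : P x = P (φ j))
    (hsum : Summable (fun i : ℕ => w i * |⟪x, φ i⟫|)) :
    w j ≤ ∑' i : ℕ, w i * |⟪x, φ i⟫| := by
  let Q : X →L[ℝ] X := ∑ i : Fin k, (innerSL ℝ (v i)).smulRight (v i)
  have hQ : ∀ y, Q y = P y := fun y => by
    simp [Q, hP, real_inner_comm]
  have hPx : HasSum (fun i => Q (φ.repr x i • φ i)) (Q x) := (φ.hasSum_repr x).mapL Q
  have hwj : w j = ‖Q x‖ := by rw [hw, max_eq_left hj, hQ, hx]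
  rw [hwj]
  refine hPx.norm_le_of_bounded hsum.hasSum fun i => ?_
  rw [map_smul, norm_smul, hQ, φ.repr_apply_apply, real_inner_comm, Real.norm_eq_abs, mul_comm, hw]
  gcongr
  exact le_max_left _ _
end

section
/- Let x† ∈ X and α > 0, and define the Tikhonov-regularized solutions x_α = ∑_{l=1}^∞ (σ_l/(σ_l² + α))⟨Kx†, u_l⟩v_l (the series converges in X) and x_{k,α} = ∑_{l=1}^k (σ_l/(σ_l² + α))⟨Kx†, u_l⟩v_l, which are the minimizers of ‖Kx − Kx†‖² + α‖x‖² and of ‖K_k x − Kx†‖² + α‖x‖², respectively. Then ‖x_α − x_{k,α}‖ ≤ (σ_{k+1}²/α)‖x†‖. -/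
open scoped RealInnerProductSpace

/-- Bessel's inequality for coefficients dominated by a multiple of the Fourier coefficients. -/
theorem Orthonormal.norm_sum_smul_le_of_abs_le {ι E : Type*} [NormedAddCommGroup E]
    [InnerProductSpace ℝ E] {v : ι → E} (hv : Orthonormal ℝ v) (s : Finset ι) {c : ι → ℝ}
    {C : ℝ} (hC : 0 ≤ C) (x : E) (hc : ∀ i ∈ s, |c i| ≤ C * |⟪x, v i⟫|) :
    ‖∑ i ∈ s, c i • v i‖ ≤ C * ‖x‖ := by
  refine le_of_sq_le_sq ?_ (by positivity)
  calc ‖∑ i ∈ s, c i • v i‖ ^ 2 = ∑ i ∈ s, c i ^ 2 := by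
        rw [← real_inner_self_eq_norm_sq, hv.inner_sum]
        simp [sq]
    _ ≤ ∑ i ∈ s, C ^ 2 * ‖⟪v i, x⟫‖ ^ 2 := by
        refine Finset.sum_le_sum fun i hi => ?_
        rw [← sq_abs, ← mul_pow, Real.norm_eq_abs, real_inner_comm]
        exact pow_le_pow_left₀ (abs_nonneg _) (hc i hi) 2
    _ ≤ (C * ‖x‖) ^ 2 := by
        rw [← Finset.mul_sum, mul_pow]
        exact mul_le_mul_of_nonneg_left (hv.sum_inner_products_le x) (sq_nonneg C)

/-- The Fourier coefficients of the sum of an orthonormal series. -/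
theorem Orthonormal.inner_left_of_hasSum {ι E : Type*} [NormedAddCommGroup E]
    [InnerProductSpace ℝ E] {u : ι → E} (hu : Orthonormal ℝ u) {a : ι → ℝ} {y : E}
    (h : HasSum (fun i => a i • u i) y) (l : ι) : ⟪y, u l⟫ = a l := by
  classical
  have hterm (i : ι) : innerSL ℝ (u l) (a i • u i) = if i = l then a l else 0 := by
    rw [innerSL_apply_apply, inner_smul_right, orthonormal_iff_ite.mp hu l i]
    by_cases hi : i = l
    · simp [hi]
    · simp [hi, Ne.symm hi]
  have hsum := h.mapL (innerSL ℝ (u l))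
  simp only [hterm] at hsum
  rw [real_inner_comm]
  exact hsum.unique (hasSum_ite_eq l (a l))

/-- For the Tikhonov-regularized solutions
`x_α = ∑_{l=1}^∞ (σ_l/(σ_l²+α))⟨Kx†,u_l⟩v_l` and
`x_{k,α} = ∑_{l=1}^k (σ_l/(σ_l²+α))⟨Kx†,u_l⟩v_l`, one has
`‖x_α − x_{k,α}‖ ≤ (σ_{k+1}²/α)‖x†‖`.
Here indices start at `0`, so the first discarded singular value is `σ k`. -/
theorem stmt_9
    {X Y : Type*} [NormedAddCommGroup X] [InnerProductSpace ℝ X]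
    [NormedAddCommGroup Y] [InnerProductSpace ℝ Y]
    (v : ℕ → X) (hv : Orthonormal ℝ v) (u : ℕ → Y) (hu : Orthonormal ℝ u)
    (σ : ℕ → ℝ) (hσpos : ∀ i, 0 < σ i) (hσmono : Antitone σ)
    (K Kk : X →L[ℝ] Y) (k : ℕ)
    (hK : ∀ x : X, HasSum (fun i : ℕ => (σ i * ⟪x, v i⟫) • u i) (K x))
    (hKk : ∀ x : X, Kk x = ∑ i ∈ Finset.range k, (σ i * ⟪x, v i⟫) • u i)
    (xd : X) (α : ℝ) (hα : 0 < α)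
    (xa xka : X)
    (hxa : HasSum
      (fun l : ℕ => (σ l / (σ l ^ 2 + α) * ⟪K xd, u l⟫) • v l) xa)
    (hxka : xka =
      ∑ l ∈ Finset.range k, (σ l / (σ l ^ 2 + α) * ⟪K xd, u l⟫) • v l) :
    ‖xa - xka‖ ≤ σ k ^ 2 / α * ‖xd‖ := by
  have hKu (l : ℕ) : ⟪K xd, u l⟫ = σ l * ⟪xd, v l⟫ := hu.inner_left_of_hasSum (hK xd) l
  refine le_of_tendsto (hxa.tendsto_sum_nat.sub_const xka).norm ?_
  filter_upwards [Filter.eventually_ge_atTop k] with n hn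
  rw [hxka, ← Finset.sum_Ico_eq_sub _ hn]
  refine hv.norm_sum_smul_le_of_abs_le _ (by positivity) xd fun l hl => ?_
  have hl' : σ l ≤ σ k := hσmono (Finset.mem_Ico.mp hl).1
  have hfac : σ l / (σ l ^ 2 + α) * σ l ≤ σ k ^ 2 / α := by
    rw [div_mul_eq_mul_div, ← sq]
    have := hσpos l
    gcongr
    nlinarith
  have hnonneg : 0 ≤ σ l / (σ l ^ 2 + α) * σ l := by
    have := hσpos l
    positivity
  rw [hKu, ← mul_assoc, abs_mul, abs_of_nonneg hnonneg]
  gcongr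
end

section
/- Fix an index j with ‖Pφ_j‖ ≥ τ and set x̄ = Pφ_j (the minimum-norm solution of the truncated problem). Then the j-th weighted component is maximal: w_j⁻¹⟨x̄, φ_j⟩ ≥ w_i⁻¹⟨x̄, φ_i⟩ for every index i. If moreover Pφ_l ≠ c·Pφ_q for all indices l ≠ q and all real scalars c, then the inequality is strict for every i ≠ j, so j is the unique maximizing index. -/
open scoped RealInnerProductSpace

/-- The projection onto the span of a finite orthonormal family is self-adjoint and idempotent,
so one may project the second argument of an inner product as well. -/
theorem Orthonormal.inner_sum_inner_smul_left {X ι : Type*} [NormedAddCommGroup X]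
    [InnerProductSpace ℝ X] [Fintype ι] {v : ι → X} (hv : Orthonormal ℝ v) (x y : X) :
    ⟪∑ i, ⟪x, v i⟫ • v i, y⟫ = ⟪∑ i, ⟪x, v i⟫ • v i, ∑ i, ⟪y, v i⟫ • v i⟫ := by
  rw [hv.inner_sum, sum_inner]
  refine Finset.sum_congr rfl fun i _ => ?_
  rw [real_inner_smul_left, real_inner_comm y (v i)]
  rfl

/-- With `x̄ = Pφ_j` and `‖Pφ_j‖ ≥ τ`, the `j`-th weighted
component of `x̄` is maximal: `w_j⁻¹⟨x̄,φ_j⟩ ≥ w_i⁻¹⟨x̄,φ_i⟩` for every `i`;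
under the non-parallelism assumption the inequality is strict for `i ≠ j`. -/
theorem stmt_10
    {X : Type*} [NormedAddCommGroup X] [InnerProductSpace ℝ X]
    (φ : HilbertBasis ℕ ℝ X) {k : ℕ} (v : Fin k → X) (hv : Orthonormal ℝ v)
    (P : X → X) (hP : ∀ x : X, P x = ∑ i : Fin k, ⟪x, v i⟫ • v i)
    (τ : ℝ) (hτ : 0 < τ)
    (w : ℕ → ℝ) (hw : ∀ i : ℕ, w i = max ‖P (φ i)‖ τ)
    (j : ℕ) (hj : τ ≤ ‖P (φ j)‖) :
    (∀ i : ℕ, (w i)⁻¹ * ⟪P (φ j), φ i⟫ ≤ (w j)⁻¹ * ⟪P (φ j), φ j⟫) ∧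
    ((∀ l q : ℕ, l ≠ q → ∀ c : ℝ, P (φ l) ≠ c • P (φ q)) →
      ∀ i : ℕ, i ≠ j →
        (w i)⁻¹ * ⟪P (φ j), φ i⟫ < (w j)⁻¹ * ⟪P (φ j), φ j⟫) := by
  have hinner (i : ℕ) : ⟪P (φ j), φ i⟫ = ⟪P (φ j), P (φ i)⟫ := by
    rw [hP (φ j), hP (φ i)]
    exact hv.inner_sum_inner_smul_left _ _
  have hpos : 0 < ‖P (φ j)‖ := hτ.trans_le hj
  have hwpos (i : ℕ) : 0 < w i := by
    rw [hw]
    exact lt_max_of_lt_right hτ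
  have hnorm_le (i : ℕ) : ‖P (φ i)‖ ≤ w i := by
    rw [hw]
    exact le_max_left _ _
  have hmax : (w j)⁻¹ * ⟪P (φ j), φ j⟫ = ‖P (φ j)‖ := by
    rw [hinner, real_inner_self_eq_norm_sq, hw, max_eq_left hj]
    field_simp
  have hbound (i : ℕ) : ‖P (φ j)‖ * ‖P (φ i)‖ ≤ w i * ‖P (φ j)‖ := by
    rw [mul_comm]
    exact mul_le_mul_of_nonneg_right (hnorm_le i) hpos.le
  refine ⟨fun i => ?_, fun hpar i hij => ?_⟩
  · rw [hmax, inv_mul_le_iff₀ (hwpos i), hinner]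
    exact (real_inner_le_norm _ _).trans (hbound i)
  · rw [hmax, inv_mul_lt_iff₀ (hwpos i), hinner]
    refine lt_of_lt_of_le (lt_of_le_of_ne (real_inner_le_norm _ _) fun heq => ?_) (hbound i)
    rw [inner_eq_norm_mul_iff_real] at heq
    refine hpar i j hij (‖P (φ j)‖⁻¹ * ‖P (φ i)‖) ?_
    rw [mul_smul, heq, inv_smul_smul₀ hpos.ne']
end

section
/- Let x† ∈ X with Kx† = y, let y^δ ∈ Y satisfy ‖y − y^δ‖ ≤ δ for some δ ≥ 0, let α > 0, let λ ∈ Y, and let R : X → ℝ be any function. Suppose x_{k,α} ∈ X satisfies (1/2)‖K_k x_{k,α} − y^δ‖² + αR(x_{k,α}) ≤ (1/2)‖K_k x† − y^δ‖² + αR(x†). Then the Bregman-type quantity d = R(x_{k,α}) − R(x†) − ⟨λ, K_k x_{k,α} − K_k x†⟩ satisfies d ≤ (σ_{k+1}‖x†‖ + δ)²/(2α) + ‖λ‖(δ + σ_{k+1}‖x†‖) + (α/2)‖λ‖². -/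
open scoped RealInnerProductSpace

/-- A finite diagonal sum with coefficients bounded by `c` has operator norm at most `c`. -/
theorem Orthonormal.norm_sum_mul_inner_smul_le {ι X Y : Type*}
    [NormedAddCommGroup X] [InnerProductSpace ℝ X]
    [NormedAddCommGroup Y] [InnerProductSpace ℝ Y]
    {v : ι → X} (hv : Orthonormal ℝ v) {u : ι → Y} (hu : Orthonormal ℝ u)
    {σ : ι → ℝ} {c : ℝ} (hc : 0 ≤ c) (s : Finset ι) (hσ : ∀ i ∈ s, |σ i| ≤ c) (x : X) :
    ‖∑ i ∈ s, (σ i * ⟪x, v i⟫) • u i‖ ≤ c * ‖x‖ := by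
  refine le_of_sq_le_sq ?_ (by positivity)
  rw [← real_inner_self_eq_norm_sq, hu.inner_sum, mul_pow]
  calc ∑ i ∈ s, (starRingEnd ℝ) (σ i * ⟪x, v i⟫) * (σ i * ⟪x, v i⟫)
      ≤ ∑ i ∈ s, c ^ 2 * ‖⟪v i, x⟫‖ ^ 2 := by
        refine Finset.sum_le_sum fun i hi => ?_
        have h : σ i ^ 2 ≤ c ^ 2 := sq_le_sq.2 ((hσ i hi).trans (le_abs_self c))
        have h' := mul_le_mul_of_nonneg_right h (sq_nonneg ⟪v i, x⟫)
        rw [real_inner_comm, Real.norm_eq_abs, sq_abs, conj_trivial]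
        linarith
    _ = c ^ 2 * ∑ i ∈ s, ‖⟪v i, x⟫‖ ^ 2 := (Finset.mul_sum _ _ _).symm
    _ ≤ c ^ 2 * ‖x‖ ^ 2 := by
        gcongr
        exact hv.sum_inner_products_le x

/-- The truncation error of a singular value expansion is bounded by the first discarded
singular value. -/
theorem Orthonormal.norm_sub_sum_range_le {X Y : Type*}
    [NormedAddCommGroup X] [InnerProductSpace ℝ X]
    [NormedAddCommGroup Y] [InnerProductSpace ℝ Y]
    {v : ℕ → X} (hv : Orthonormal ℝ v) {u : ℕ → Y} (hu : Orthonormal ℝ u)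
    {σ : ℕ → ℝ} (hσ0 : ∀ i, 0 ≤ σ i) (hσ : Antitone σ) {x : X} {z : Y}
    (hz : HasSum (fun i : ℕ => (σ i * ⟪x, v i⟫) • u i) z) (k : ℕ) :
    ‖z - ∑ i ∈ Finset.range k, (σ i * ⟪x, v i⟫) • u i‖ ≤ σ k * ‖x‖ := by
  have htail := (hasSum_nat_add_iff' k).2 hz
  refine le_of_tendsto htail.norm (Filter.Eventually.of_forall fun s => ?_)
  refine (hv.comp (· + k) (add_left_injective k)).norm_sum_mul_inner_smul_le
    (hu.comp (· + k) (add_left_injective k)) (hσ0 k) s (σ := fun i => σ (i + k)) ?_ x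
  intro i _
  rw [abs_of_nonneg (hσ0 _)]
  exact hσ (Nat.le_add_left k i)

/-- Bregman-type error bound: if `x_{k,α}` has smaller (truncated)
Tikhonov value than `x†`, then
`d = R(x_{k,α}) − R(x†) − ⟨λ, K_k x_{k,α} − K_k x†⟩` satisfies
`d ≤ (σ_{k+1}‖x†‖+δ)²/(2α) + ‖λ‖(δ + σ_{k+1}‖x†‖) + (α/2)‖λ‖²`.
Here indices start at `0`, so the first discarded singular value is `σ k`. -/
theorem stmt_11
    {X Y : Type*} [NormedAddCommGroup X] [InnerProductSpace ℝ X]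
    [NormedAddCommGroup Y] [InnerProductSpace ℝ Y]
    (v : ℕ → X) (hv : Orthonormal ℝ v) (u : ℕ → Y) (hu : Orthonormal ℝ u)
    (σ : ℕ → ℝ) (hσpos : ∀ i, 0 < σ i) (hσmono : Antitone σ)
    (K Kk : X →L[ℝ] Y) (k : ℕ)
    (hK : ∀ x : X, HasSum (fun i : ℕ => (σ i * ⟪x, v i⟫) • u i) (K x))
    (hKk : ∀ x : X, Kk x = ∑ i ∈ Finset.range k, (σ i * ⟪x, v i⟫) • u i)
    (xd : X) (y yδ : Y) (δ : ℝ) (hδ0 : 0 ≤ δ)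
    (hy : K xd = y) (hnoise : ‖y - yδ‖ ≤ δ)
    (α : ℝ) (hα : 0 < α) (lam : Y) (R : X → ℝ)
    (xka : X)
    (hmin : (1 / 2) * ‖Kk xka - yδ‖ ^ 2 + α * R xka ≤
      (1 / 2) * ‖Kk xd - yδ‖ ^ 2 + α * R xd)
    (d : ℝ) (hd : d = R xka - R xd - ⟪lam, Kk xka - Kk xd⟫) :
    d ≤ (σ k * ‖xd‖ + δ) ^ 2 / (2 * α) + ‖lam‖ * (δ + σ k * ‖xd‖) +
      α / 2 * ‖lam‖ ^ 2 := by
  have htrunc := hv.norm_sub_sum_range_le hu (fun i => (hσpos i).le) hσmono (hK xd) k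
  rw [← hKk, hy] at htrunc
  set a := Kk xka - yδ with ha
  set e := Kk xd - yδ with he
  set E := σ k * ‖xd‖ + δ with hE
  have hbound : ‖e‖ ≤ E := by
    have h := norm_sub_le (y - yδ) (y - Kk xd)
    rw [sub_sub_sub_cancel_left] at h
    linarith
  have hinner : -⟪lam, Kk xka - Kk xd⟫ ≤ ‖lam‖ * ‖a‖ + ‖lam‖ * ‖e‖ := by
    rw [show Kk xka - Kk xd = a - e by simp [ha, he], inner_sub_right]
    linarith [neg_le_of_abs_le (abs_real_inner_le_norm lam a), real_inner_le_norm lam e]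
  have hR : R xka - R xd ≤ (E ^ 2 - ‖a‖ ^ 2) / (2 * α) := by
    rw [le_div_iff₀ (by positivity)]
    have := pow_le_pow_left₀ (norm_nonneg e) hbound 2
    linarith
  have hyoung : ‖lam‖ * ‖a‖ ≤ ‖a‖ ^ 2 / (2 * α) + α / 2 * ‖lam‖ ^ 2 := by
    have h : 0 ≤ (‖a‖ - α * ‖lam‖) ^ 2 / (2 * α) := by positivity
    have h' : (‖a‖ - α * ‖lam‖) ^ 2 / (2 * α) =
        ‖a‖ ^ 2 / (2 * α) + α / 2 * ‖lam‖ ^ 2 - ‖lam‖ * ‖a‖ := by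
      field_simp
      ring
    linarith
  have hnorm := mul_le_mul_of_nonneg_left hbound (norm_nonneg lam)
  rw [sub_div] at hR
  rw [add_comm δ, ← hE]
  linarith
end

section
/- Fix an index j with ‖Pφ_j‖ ≥ τ, so that w_j = ‖Pφ_j‖. Then ζ = w_j⁻¹Pφ_j is a subgradient of the weighted ℓ¹ functional at φ_j: for every x ∈ X for which the series ∑_i w_i|⟨x,φ_i⟩| converges, ∑_i w_i|⟨x,φ_i⟩| ≥ w_j + ⟨ζ, x − φ_j⟩. -/
open scoped RealInnerProductSpace

/-- The orthogonal projection onto the span of a finite orthonormal family is a symmetric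
idempotent. -/
theorem Orthonormal.inner_sum_smul_left_eq {X ι : Type*} [NormedAddCommGroup X]
    [InnerProductSpace ℝ X] [Fintype ι] {v : ι → X} (hv : Orthonormal ℝ v) (a b : X) :
    ⟪∑ i, ⟪a, v i⟫ • v i, b⟫ = ⟪∑ i, ⟪a, v i⟫ • v i, ∑ i, ⟪b, v i⟫ • v i⟫ := by
  rw [hv.inner_sum, sum_inner]
  refine Finset.sum_congr rfl fun i _ => ?_
  rw [real_inner_smul_left, real_inner_comm b]
  simp

/-- With `‖Pφ_j‖ ≥ τ` (so `w_j = ‖Pφ_j‖`), the element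
`ζ = w_j⁻¹ Pφ_j` is a subgradient of the weighted ℓ¹ functional at `φ_j`:
`∑_i w_i|⟨x,φ_i⟩| ≥ w_j + ⟨ζ, x − φ_j⟩` for every admissible `x`. -/
theorem stmt_13
    {X : Type*} [NormedAddCommGroup X] [InnerProductSpace ℝ X]
    (φ : HilbertBasis ℕ ℝ X) {k : ℕ} (v : Fin k → X) (hv : Orthonormal ℝ v)
    (P : X → X) (hP : ∀ x : X, P x = ∑ i : Fin k, ⟪x, v i⟫ • v i)
    (τ : ℝ) (hτ : 0 < τ)
    (w : ℕ → ℝ) (hw : ∀ i : ℕ, w i = max ‖P (φ i)‖ τ)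
    (j : ℕ) (hj : τ ≤ ‖P (φ j)‖) :
    ∀ x : X, Summable (fun i : ℕ => w i * |⟪x, φ i⟫|) →
      w j + ⟪(w j)⁻¹ • P (φ j), x - φ j⟫ ≤ ∑' i : ℕ, w i * |⟪x, φ i⟫| := by
  intro x hx
  have hproj (a b : X) : ⟪P a, b⟫ = ⟪P a, P b⟫ := by
    simp only [hP]
    exact hv.inner_sum_smul_left_eq a b
  have hwj : w j = ‖P (φ j)‖ := by rw [hw, max_eq_left hj]
  have hpos : 0 < w j := hwj ▸ hτ.trans_le hj
  set ζ := (w j)⁻¹ • P (φ j) with hζ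
  have hζ_self : ⟪ζ, φ j⟫ = w j := by
    rw [hζ, real_inner_smul_left, hproj, real_inner_self_eq_norm_sq, ← hwj]
    field_simp
  have hζ_norm : ‖ζ‖ = 1 := by
    rw [hζ, norm_smul, ← hwj, norm_inv, Real.norm_of_nonneg hpos.le,
      inv_mul_cancel₀ hpos.ne']
  have hζ_le (i : ℕ) : |⟪ζ, φ i⟫| ≤ w i := by
    have h : ⟪ζ, φ i⟫ = ⟪ζ, P (φ i)⟫ := by
      rw [hζ, real_inner_smul_left, hproj, real_inner_smul_left]
    calc |⟪ζ, φ i⟫| ≤ ‖ζ‖ * ‖P (φ i)‖ := h ▸ abs_real_inner_le_norm _ _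
      _ = ‖P (φ i)‖ := by rw [hζ_norm, one_mul]
      _ ≤ w i := hw i ▸ le_max_left _ _
  have hζ_x : ⟪ζ, x⟫ ≤ ∑' i : ℕ, w i * |⟪x, φ i⟫| := by
    refine hasSum_le (fun i => ?_) (φ.hasSum_inner_mul_inner ζ x) hx.hasSum
    calc ⟪ζ, φ i⟫ * ⟪φ i, x⟫ ≤ |⟪ζ, φ i⟫| * |⟪x, φ i⟫| := by
          rw [real_inner_comm x, ← abs_mul]
          exact le_abs_self _
      _ ≤ w i * |⟪x, φ i⟫| := by gcongr; exact hζ_le i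
  rw [inner_sub_right, hζ_self]
  linarith
end
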